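/- Let Σ_A be the renewal shift and φ : Σ_A → ℝ a weakly Hölder continuous potential with sup φ < ∞ and Var_1 φ < ∞, and let β_c ∈ (0,∞] be such that βφ is positive recurrent for every β ∈ (0,β_c) and βφ is transient for every β > β_c. Then for every β ∈ (0,β_c), every σ-finite Borel measure ν on Σ_A, finite on every cylinder, with L*_{βφ} ν = e^{P_G(βφ)} ν satisfies ν(Σ_A) < ∞. -/

import Mathlib

open MeasureTheory Filter Topology ENNReal

namespace CMS

/-- A sequence is admissible for the transition matrix `A`. -/
def IsAdm (A : ℕ → ℕ → Bool) (u : ℕ → ℕ) : Prop := ∀ i, A (u i) (u (i + 1)) = true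

/-- The one-sided countable topological Markov shift. -/
abbrev Space (A : ℕ → ℕ → Bool) := {u : ℕ → ℕ // IsAdm A u}

/-- The transition matrix has no row and no column identically zero. -/
def NoDegenerate (A : ℕ → ℕ → Bool) : Prop :=
  (∀ i, ∃ j, A i j = true) ∧ (∀ j, ∃ i, A i j = true)

/-- The shift map. -/
def shift {A : ℕ → ℕ → Bool} (x : Space A) : Space A :=
  ⟨fun i => x.1 (i + 1), fun i => x.2 (i + 1)⟩

/-- Birkhoff (ergodic) sum `φ_n`. -/
noncomputable def birkhoff {A : ℕ → ℕ → Bool} (φ : Space A → ℝ) (n : ℕ) (x : Space A) : ℝ :=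
  ∑ i ∈ Finset.range n, φ (shift^[i] x)

/-- The cylinder set determined by a word. -/
def cyl (A : ℕ → ℕ → Bool) (w : List ℕ) : Set (Space A) :=
  {x | ∀ i : Fin w.length, x.1 i = w.get i}

/-- Concatenation of a finite word with a sequence. -/
def concatSeq (w : List ℕ) (u : ℕ → ℕ) : ℕ → ℕ :=
  fun i => if h : i < w.length then w.get ⟨i, h⟩ else u (i - w.length)

/-- Prepending a single symbol to a sequence. -/
def prependSeq (a : ℕ) (u : ℕ → ℕ) : ℕ → ℕ := fun i => Nat.casesOn i a u

/-- The set of points to which the symbol `a` may be prepended. -/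
def admits (A : ℕ → ℕ → Bool) (a : ℕ) : Set (Space A) := {x | A a (x.1 0) = true}

/-- Prepending a symbol to a point of the shift space (identity if not admissible). -/
noncomputable def prep (A : ℕ → ℕ → Bool) (a : ℕ) (x : Space A) : Space A :=
  if h : A a (x.1 0) = true then
    ⟨prependSeq a x.1, by
      intro i
      cases i with
      | zero => exact h
      | succ j => exact x.2 j⟩
  else x

/-- The measure `ν ⊚ σ`, `ν⊚σ(E) = Σ_a ν(σ(E ∩ [a]))`. -/
noncomputable def circ (A : ℕ → ℕ → Bool) (ν : Measure (Space A)) : Measure (Space A) :=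
  Measure.sum fun a : ℕ => (ν.restrict (admits A a)).map (prep A a)

/-- `ν` is `(φ, l)`-conformal: `dν/d(ν⊚σ) = l⁻¹ e^φ`. -/
def Conformal (A : ℕ → ℕ → Bool) (φ : Space A → ℝ) (l : ℝ) (ν : Measure (Space A)) : Prop :=
  ∀ E : Set (Space A), MeasurableSet E →
    ν E = ∫⁻ x in E, ENNReal.ofReal (l⁻¹ * Real.exp (φ x)) ∂(circ A ν)

/-- The Ruelle transfer operator. -/
noncomputable def ruelle (A : ℕ → ℕ → Bool) (φ f : Space A → ℝ) (x : Space A) : ℝ :=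
  ∑' a : ℕ, if A a (x.1 0) = true then Real.exp (φ (prep A a x)) * f (prep A a x) else 0

/-- The Ruelle operator applied to the constant function 1, valued in `ℝ≥0∞`. -/
noncomputable def ruelleOne (A : ℕ → ℕ → Bool) (φ : Space A → ℝ) (x : Space A) : ℝ≥0∞ :=
  ∑' a : ℕ, if A a (x.1 0) = true then ENNReal.ofReal (Real.exp (φ (prep A a x))) else 0

/-- `L*_φ ν = l ν` : the dual eigenmeasure equation. -/
def DualEigen (A : ℕ → ℕ → Bool) (φ : Space A → ℝ) (l : ℝ) (ν : Measure (Space A)) : Prop :=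
  ∀ f : Space A → ℝ, Integrable f ν →
    ∫ x, ruelle A φ f x ∂ν = l * ∫ x, f x ∂ν

/-- The sub-σ-algebra `σ^{-n} 𝓑`. -/
def shiftSigma (A : ℕ → ℕ → Bool) (n : ℕ) : MeasurableSpace (Space A) :=
  MeasurableSpace.comap (shift^[n]) inferInstance

/-- A sub-σ-algebra `m` is compatible with `ν`: the restriction of `ν` to `m` is σ-finite. -/
def Compatible (A : ℕ → ℕ → Bool) (ν : Measure (Space A))
    (m : MeasurableSpace (Space A)) : Prop :=
  ∃ s : ℕ → Set (Space A), (∀ k, MeasurableSet[m] (s k)) ∧ (∀ k, ν (s k) ≠ ⊤) ∧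
    (⋃ k, s k) = Set.univ

open Classical in
/-- Numerator of the DLR kernel: `e^{φ_n(w σ^n x)} 1{w σ^n x ∈ Σ_A}`. -/
noncomputable def dlrNum (A : ℕ → ℕ → Bool) (φ : Space A → ℝ) (w : List ℕ)
    (x : Space A) : ℝ :=
  if h : IsAdm A (concatSeq w ((shift^[w.length] x).1)) then
    Real.exp (birkhoff φ w.length (⟨concatSeq w ((shift^[w.length] x).1), h⟩ : Space A))
  else 0

/-- Denominator of the DLR kernel: `Σ_{y : σ^n y = σ^n x} e^{φ_n(y)}`. -/
noncomputable def dlrDen (A : ℕ → ℕ → Bool) (φ : Space A → ℝ) (n : ℕ) (x : Space A) : ℝ :=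
  ∑' y : {y : Space A // shift^[n] y = shift^[n] x}, Real.exp (birkhoff φ n y.1)

/-- `ν` is a `φ`-DLR measure. -/
def IsDLR (A : ℕ → ℕ → Bool) (φ : Space A → ℝ) (ν : Measure (Space A)) : Prop :=
  ∀ n : ℕ, 1 ≤ n →
    Compatible A ν (shiftSigma A n) ∧
    ∀ w : List ℕ, w.length = n →
      (ν[Set.indicator (cyl A w) (fun _ => (1 : ℝ))|shiftSigma A n])
        =ᵐ[ν] fun x => dlrNum A φ w x / dlrDen A φ n x

/-- `ν` is non-singular: `ν ∘ σ⁻¹ ∼ ν`. -/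
def NonSingular (A : ℕ → ℕ → Bool) (ν : Measure (Space A)) : Prop :=
  ν.map shift ≪ ν ∧ ν ≪ ν.map shift

/-- Conservative non-singular measure. -/
def Conservative (A : ℕ → ℕ → Bool) (ν : Measure (Space A)) : Prop :=
  NonSingular A ν ∧
    ∀ W : Set (Space A), MeasurableSet W →
      (∀ i j : ℕ, i ≠ j → ν ((shift^[i] ⁻¹' W) ∩ (shift^[j] ⁻¹' W)) = 0) → ν W = 0

/-- The `n`-th variation `Var_n φ`, valued in `ℝ≥0∞`. -/
noncomputable def varn (A : ℕ → ℕ → Bool) (φ : Space A → ℝ) (n : ℕ) : ℝ≥0∞ :=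
  ⨆ (x : Space A) (y : Space A) (_ : ∀ i, i < n → x.1 i = y.1 i),
    ENNReal.ofReal |φ x - φ y|

noncomputable def waltersBound (A : ℕ → ℕ → Bool) (φ : Space A → ℝ) (k : ℕ) : ℝ≥0∞ :=
  ⨆ (n : ℕ) (_ : 1 ≤ n), varn A (birkhoff φ n) (n + k)

/-- The Walters condition. -/
def Walters (A : ℕ → ℕ → Bool) (φ : Space A → ℝ) : Prop :=
  (∀ k, 1 ≤ k → waltersBound A φ k ≠ ⊤) ∧
  Tendsto (waltersBound A φ) atTop (nhds 0)

/-- `φ` is weakly Hölder continuous. -/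
def WeaklyHolder (A : ℕ → ℕ → Bool) (φ : Space A → ℝ) : Prop :=
  ∃ H θ : ℝ, 0 < H ∧ θ ∈ Set.Ioo (0 : ℝ) 1 ∧
    ∀ n : ℕ, 2 ≤ n → varn A φ n ≤ ENNReal.ofReal (H * θ ^ n)

/-- The partition function `Z_n(φ, a)`, valued in `ℝ≥0∞`. -/
noncomputable def Zn (A : ℕ → ℕ → Bool) (φ : Space A → ℝ) (n a : ℕ) : ℝ≥0∞ :=
  ∑' x : {x : Space A // shift^[n] x = x ∧ x.1 0 = a},
    ENNReal.ofReal (Real.exp (birkhoff φ n x.1))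

/-- The partition function `Z*_n(φ, a)` over periodic points whose first return to `[a]` is `n`. -/
noncomputable def Znstar (A : ℕ → ℕ → Bool) (φ : Space A → ℝ) (n a : ℕ) : ℝ≥0∞ :=
  ∑' x : {x : Space A // shift^[n] x = x ∧ x.1 0 = a ∧
      ∀ k, 0 < k → k < n → (shift^[k] x).1 0 ≠ a},
    ENNReal.ofReal (Real.exp (birkhoff φ n x.1))

/-- `P` is the (finite) Gurevich pressure of `φ`. -/
def HasGurevich (A : ℕ → ℕ → Bool) (φ : Space A → ℝ) (P : ℝ) : Prop :=
  ∀ a : ℕ, (cyl A [a]).Nonempty →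
    (∀ n, 1 ≤ n → Zn A φ n a ≠ ⊤) ∧
    Tendsto (fun n : ℕ => Real.log (Zn A φ n a).toReal / n) atTop (nhds P)

/-- `φ` is recurrent (with Gurevich pressure `P`). -/
def Recurrent (A : ℕ → ℕ → Bool) (φ : Space A → ℝ) (P : ℝ) : Prop :=
  ∀ a : ℕ, (cyl A [a]).Nonempty →
    ∑' n : ℕ, ENNReal.ofReal (Real.exp (-((n + 1 : ℕ) : ℝ) * P)) * Zn A φ (n + 1) a = ⊤

/-- `φ` is positive recurrent (with Gurevich pressure `P`). -/
def PosRecurrent (A : ℕ → ℕ → Bool) (φ : Space A → ℝ) (P : ℝ) : Prop :=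
  Recurrent A φ P ∧
  ∀ a : ℕ, (cyl A [a]).Nonempty →
    ∑' n : ℕ, ((n + 1 : ℕ) : ℝ≥0∞) *
      ENNReal.ofReal (Real.exp (-((n + 1 : ℕ) : ℝ) * P)) * Znstar A φ (n + 1) a ≠ ⊤

/-- `φ` is transient (with Gurevich pressure `P`). -/
def Transient (A : ℕ → ℕ → Bool) (φ : Space A → ℝ) (P : ℝ) : Prop :=
  ∀ a : ℕ, (cyl A [a]).Nonempty →
    ∑' n : ℕ, ENNReal.ofReal (Real.exp (-((n + 1 : ℕ) : ℝ) * P)) * Zn A φ (n + 1) a ≠ ⊤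

/-- `Σ_A` is topologically mixing. -/
def TopMixing (A : ℕ → ℕ → Bool) : Prop :=
  ∀ a b : ℕ, ∃ N : ℕ, ∀ n, N < n → ∃ x : Space A, x.1 0 = a ∧ (shift^[n] x).1 0 = b

/-- The big images and preimages (BIP) property. -/
def BIP (A : ℕ → ℕ → Bool) : Prop :=
  ∃ (N : ℕ) (b : Fin N → ℕ), ∀ a : ℕ,
    (∃ i, A (b i) a = true) ∧ (∃ j, A a (b j) = true)

/-- An admissible word. -/
def AdmWord (A : ℕ → ℕ → Bool) (w : List ℕ) : Prop :=
  ∀ (i : ℕ) (h : i + 1 < w.length),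
    A (w.get ⟨i, Nat.lt_of_succ_lt h⟩) (w.get ⟨i + 1, h⟩) = true

/-- The image of `E ⊆ [a̲]` under the cylinder-swapping map `v_{a̲,b̲}`. -/
def swapImage (A : ℕ → ℕ → Bool) (b : List ℕ) (E : Set (Space A)) : Set (Space A) :=
  {y | ∃ x ∈ E, y.1 = concatSeq b ((shift^[b.length] x).1)}

/-- The image of `E` under the prepending map `I_b`. -/
def prepImage (A : ℕ → ℕ → Bool) (b : ℕ) (E : Set (Space A)) : Set (Space A) :=
  {y | ∃ x ∈ E, y.1 = prependSeq b x.1}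

/-- The transition matrix of the renewal shift:
`A(1,1) = A(1,i) = A(i,i-1) = 1` (for `i > 1`), all other entries `0`. -/
def renA : ℕ → ℕ → Bool := fun i j => decide ((i = 1 ∧ 1 ≤ j) ∨ (2 ≤ i ∧ j = i - 1))

/-- The transition matrix of the shift `Σ_{𝓡⁻}`:
`A(i,i+1) = A(i,1) = 1` for `i ≥ 1`, all other entries `0`. -/
def rminusA : ℕ → ℕ → Bool := fun i j => decide (1 ≤ i ∧ (j = i + 1 ∨ j = 1))

/-- The periodic sequence obtained by repeating the word `w`. -/
def perSeq (w : List ℕ) : ℕ → ℕ := fun i => w.getD (i % w.length) 0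

/-- The word `(j, j-1, …, 1, n, n-1, …, j+1)`. -/
def gammaWord (j n : ℕ) : List ℕ :=
  ((List.range j).map (· + 1)).reverse ++ ((List.range (n - j)).map (· + (j + 1))).reverse

/-- The point `x̄ = (1, 2, 3, …)` of `Σ_{𝓡⁻}`. -/
def xbar : Space rminusA := ⟨fun i => i + 1, by intro i; simp [rminusA]⟩

lemma shift_iterate_apply {A : ℕ → ℕ → Bool} (j : ℕ) (x : Space A) (i : ℕ) :
    (shift^[j] x).1 i = x.1 (i + j) := by
  induction j generalizing x i with
  | zero => rfl
  | succ j ih =>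
    rw [Function.iterate_succ_apply, ih]
    change x.1 (i + j + 1) = _
    rw [add_assoc]

lemma mem_cyl_singleton {A : ℕ → ℕ → Bool} {a : ℕ} {x : Space A} :
    x ∈ cyl A [a] ↔ x.1 0 = a := by
  constructor
  · intro h
    simpa using h ⟨0, by simp⟩
  · rintro h ⟨i, hi⟩
    obtain rfl : i = 0 := by simpa using hi
    simpa using h

lemma measurableSet_cyl_singleton (A : ℕ → ℕ → Bool) (a : ℕ) :
    MeasurableSet (cyl A [a]) := by
  have h : cyl A [a] = (fun x : Space A => x.1 0) ⁻¹' {a} := by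
    ext x
    simp [mem_cyl_singleton]
  rw [h]
  exact ((measurable_pi_apply 0).comp measurable_subtype_coe) (measurableSet_singleton a)

lemma abs_sub_le_of_varn_le {A : ℕ → ℕ → Bool} {φ : Space A → ℝ} {n : ℕ} {c : ℝ} (hc : 0 ≤ c)
    (h : varn A φ n ≤ ENNReal.ofReal c) {x y : Space A} (hxy : ∀ i, i < n → x.1 i = y.1 i) :
    |φ x - φ y| ≤ c := by
  have h1 : ENNReal.ofReal |φ x - φ y| ≤ varn A φ n :=
    le_iSup_of_le x (le_iSup_of_le y (le_iSup_of_le hxy le_rfl))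
  exact (ENNReal.ofReal_le_ofReal_iff hc).1 (h1.trans h)

lemma prep_apply_zero {A : ℕ → ℕ → Bool} {a : ℕ} {x : Space A} (h : A a (x.1 0) = true) :
    (prep A a x).1 0 = a := by
  simp [prep, h, prependSeq]

/-- The Ruelle operator applied to the indicator of a cylinder of length one. -/
lemma ruelle_indicator_cyl (A : ℕ → ℕ → Bool) (ψ : Space A → ℝ) (k : ℕ) (x : Space A) :
    ruelle A ψ ((cyl A [k]).indicator fun _ => 1) x =
      if A k (x.1 0) = true then Real.exp (ψ (prep A k x)) else 0 := by
  unfold ruelle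
  rw [tsum_eq_single k]
  · split_ifs with h
    · rw [Set.indicator_of_mem (mem_cyl_singleton.2 (prep_apply_zero h)), mul_one]
    · rfl
  · intro a ha
    split_ifs with h
    · rw [Set.indicator_of_notMem, mul_zero]
      rwa [mem_cyl_singleton, prep_apply_zero h]
    · rfl

lemma renA_apply_zero_pos (x : Space renA) : 1 ≤ x.1 0 := by
  have := x.2 0
  simp only [renA, decide_eq_true_eq] at this
  omega

lemma renA_apply_of_le {k : ℕ} {x : Space renA} (hx : x.1 0 = k + 1) {i : ℕ} (hi : i ≤ k) :
    x.1 i = k + 1 - i := by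
  induction i with
  | zero => simpa using hx
  | succ i ih =>
    have h1 := ih (by omega)
    have := x.2 i
    simp only [renA, decide_eq_true_eq] at this
    omega

/-- The periodic point of the renewal shift with period word `(1, n + 1, n, …, 2)`. -/
def renPer (n : ℕ) : Space renA :=
  ⟨fun i => if i % (n + 1) = 0 then 1 else n + 2 - i % (n + 1), by
    intro i
    have h1 : i % (n + 1) < n + 1 := Nat.mod_lt _ (by omega)
    have h2 : (i + 1) % (n + 1) = if i % (n + 1) = n then 0 else i % (n + 1) + 1 := by
      rw [Nat.add_mod_eq_ite]
      rcases Nat.eq_zero_or_pos n with rfl | hn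
      · simp [Nat.mod_one]
      · rw [Nat.mod_eq_of_lt (show 1 < n + 1 by omega)]
        split_ifs <;> omega
    simp only [renA, decide_eq_true_eq, h2]
    generalize i % (n + 1) = r at h1
    by_cases hr : r = n
    · subst hr
      simp only [if_true]
      split_ifs <;> omega
    · simp only [hr, if_false, Nat.succ_ne_zero]
      split_ifs <;> omega⟩

lemma renPer_apply_zero (n : ℕ) : (renPer n).1 0 = 1 := by simp [renPer]

lemma renPer_apply {n i : ℕ} (h0 : 0 < i) (hi : i < n + 1) : (renPer n).1 i = n + 2 - i := by
  simp [renPer, Nat.mod_eq_of_lt hi, h0.ne']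

lemma shift_iterate_renPer (n : ℕ) : shift^[n + 1] (renPer n) = renPer n := by
  apply Subtype.ext
  funext i
  rw [shift_iterate_apply]
  simp [renPer]

lemma exp_birkhoff_renPer_le_Znstar (ψ : Space renA → ℝ) (n : ℕ) :
    ENNReal.ofReal (Real.exp (birkhoff ψ (n + 1) (renPer n))) ≤ Znstar renA ψ (n + 1) 1 := by
  refine ENNReal.le_tsum (f := fun x : {x : Space renA // shift^[n + 1] x = x ∧ x.1 0 = 1 ∧
      ∀ k, 0 < k → k < n + 1 → (shift^[k] x).1 0 ≠ 1} =>
    ENNReal.ofReal (Real.exp (birkhoff ψ (n + 1) x.1)))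
    ⟨renPer n, shift_iterate_renPer n, renPer_apply_zero n, fun k h0 hk => ?_⟩
  rw [shift_iterate_apply, zero_add, renPer_apply h0 hk]
  omega

/-- An eigenmeasure of the dual Ruelle operator scales between consecutive cylinders by at most
the supremum of the weight. -/
lemma DualEigen.measureReal_cyl_succ_le {ψ : Space renA → ℝ} {l : ℝ} {ν : Measure (Space renA)}
    (hν : DualEigen renA ψ l ν) (hfin : ∀ w : List ℕ, w ≠ [] → ν (cyl renA w) ≠ ⊤)
    {k : ℕ} (hk : 1 ≤ k) {c : ℝ} (hc : ∀ x : Space renA, x.1 0 = k + 1 → ψ x ≤ c) :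
    l * ν.real (cyl renA [k + 1]) ≤ Real.exp c * ν.real (cyl renA [k]) := by
  have hm := measurableSet_cyl_singleton renA
  have h1 := hν ((cyl renA [k + 1]).indicator fun _ => 1)
    ((integrable_indicator_iff (hm _)).2 (integrableOn_const (hfin _ (by simp))))
  rw [integral_indicator_const _ (hm _), smul_eq_mul, mul_one] at h1
  rw [← h1, mul_comm, ← smul_eq_mul, ← integral_indicator_const _ (hm _)]
  refine integral_mono_of_nonneg (ae_of_all _ fun x => ?_)
    ((integrable_indicator_iff (hm _)).2 (integrableOn_const (hfin _ (by simp))))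
    (ae_of_all _ fun x => ?_)
  · simp only [Pi.zero_apply, ruelle_indicator_cyl]
    split_ifs <;> positivity
  · simp only [ruelle_indicator_cyl]
    split_ifs with h
    · have h0 : x.1 0 = k := by
        simp only [renA, decide_eq_true_eq] at h
        omega
      rw [Set.indicator_of_mem (mem_cyl_singleton.2 h0)]
      exact Real.exp_le_exp.2 (hc _ (prep_apply_zero h))
    · exact Set.indicator_nonneg (fun _ _ => (Real.exp_pos _).le) x

theorem statement13 (φ : Space renA → ℝ)
    (hH : WeaklyHolder renA φ) (hsup : BddAbove (Set.range φ))
    (hvar : varn renA φ 1 ≠ ⊤)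
    (βc : ℝ≥0∞) (hβc : 0 < βc)
    (P : ℝ → ℝ)
    (hP : ∀ β : ℝ, 0 < β → HasGurevich renA (fun x => β * φ x) (P β))
    (hrec : ∀ β : ℝ, 0 < β → ENNReal.ofReal β < βc →
      PosRecurrent renA (fun x => β * φ x) (P β))
    (htr : ∀ β : ℝ, βc < ENNReal.ofReal β →
      Transient renA (fun x => β * φ x) (P β)) :
    ∀ β : ℝ, 0 < β → ENNReal.ofReal β < βc →
      ∀ ν : Measure (Space renA), SigmaFinite ν →
        (∀ w : List ℕ, w ≠ [] → ν (cyl renA w) ≠ ⊤) →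
        DualEigen renA (fun x => β * φ x) (Real.exp (P β)) ν →
        ν Set.univ ≠ ⊤ := by
  intro β hβ hββc ν _ hfin hν
  obtain ⟨H, θ, hHpos, ⟨hθ0, hθ1⟩, hvarn⟩ := hH
  set V := (varn renA φ 1).toReal
  set p := P β
  have hV1 : ∀ n, φ (renPer 0) - V ≤ φ (renPer n) := fun n => by
    have := abs_sub_le_of_varn_le (x := renPer 0) (y := renPer n) ENNReal.toReal_nonneg
      (ENNReal.ofReal_toReal hvar).ge (fun i hi => by
        obtain rfl : i = 0 := by omega
        rw [renPer_apply_zero, renPer_apply_zero])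
    linarith [(abs_le.1 this).2]
  have hgeom : ∀ n, ∑ i ∈ Finset.range n, θ ^ (i + 2) ≤ (1 - θ)⁻¹ := fun n => by
    rw [← tsum_geometric_of_lt_one hθ0.le hθ1]
    refine le_trans (Finset.sum_le_sum fun i _ => ?_)
      ((summable_geometric_of_lt_one hθ0.le hθ1).sum_le_tsum (Finset.range n)
        fun i _ => pow_nonneg hθ0.le i)
    exact pow_le_pow_of_le_one hθ0.le hθ1.le (by omega)
  have hstep : ∀ n k, k ≤ n → ν.real (cyl renA [k + 1]) ≤
      ν.real (cyl renA [1]) * Real.exp (β * ∑ i ∈ Finset.range k,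
        (φ (shift^[n - i] (renPer n)) + H * θ ^ (i + 2)) - k * p) := by
    intro n k
    induction k with
    | zero => simp
    | succ k ih =>
      intro hk
      have hb := hν.measureReal_cyl_succ_le hfin (k := k + 1) (by omega)
        (c := β * (φ (shift^[n - k] (renPer n)) + H * θ ^ (k + 2))) (fun x hx => by
          refine mul_le_mul_of_nonneg_left ?_ hβ.le
          have hy : (shift^[n - k] (renPer n)).1 0 = k + 1 + 1 := by
            rw [shift_iterate_apply, zero_add, renPer_apply (by omega) (by omega)]
            omega
          have := abs_sub_le_of_varn_le (by positivity) (hvarn (k + 2) (by omega))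
            (x := x) (y := shift^[n - k] (renPer n)) (fun i hi => by
              rw [renA_apply_of_le hx (by omega), renA_apply_of_le hy (by omega)])
          linarith [(abs_le.1 this).2])
      have hb' := hb.trans (mul_le_mul_of_nonneg_left (ih (by omega)) (Real.exp_pos _).le)
      rw [← le_div_iff₀' (Real.exp_pos p)] at hb'
      refine hb'.trans_eq ?_
      rw [div_eq_mul_inv, ← Real.exp_neg, mul_left_comm, mul_assoc, ← Real.exp_add,
        ← Real.exp_add, Finset.sum_range_succ]
      congr 2
      push_cast
      ring
  set C := ν.real (cyl renA [1]) *
    Real.exp (β * H * (1 - θ)⁻¹ - β * (φ (renPer 0) - V) + p) with hC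
  have hC0 : 0 ≤ C := by positivity
  have hcyl : ∀ n : ℕ, ν (cyl renA [n + 1]) ≤ ENNReal.ofReal C *
      (((n + 1 : ℕ) : ℝ≥0∞) * ENNReal.ofReal (Real.exp (-((n + 1 : ℕ) : ℝ) * p)) *
        Znstar renA (fun x => β * φ x) (n + 1) 1) := by
    intro n
    have hreal : ν.real (cyl renA [n + 1]) ≤ C * (Real.exp (-((n + 1 : ℕ) : ℝ) * p) *
        Real.exp (birkhoff (fun x => β * φ x) (n + 1) (renPer n))) := by
      refine (hstep n n le_rfl).trans ?_
      rw [hC, mul_assoc, ← Real.exp_add, ← Real.exp_add]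
      refine mul_le_mul_of_nonneg_left (Real.exp_le_exp.2 ?_) measureReal_nonneg
      have hrefl : ∑ i ∈ Finset.range n, φ (shift^[n - i] (renPer n)) =
          ∑ i ∈ Finset.range n, φ (shift^[i + 1] (renPer n)) := by
        rw [← Finset.sum_range_reflect]
        refine Finset.sum_congr rfl fun i hi => ?_
        rw [Finset.mem_range] at hi
        congr 2
        omega
      rw [birkhoff, ← Finset.mul_sum, Finset.sum_range_succ', Finset.sum_add_distrib, hrefl,
        ← Finset.mul_sum, Function.iterate_zero, id_eq]
      have h1 := mul_le_mul_of_nonneg_left (hgeom n) (mul_pos hβ hHpos).le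
      have h2 := mul_le_mul_of_nonneg_left (hV1 n) hβ.le
      push_cast
      linarith
    rw [← ENNReal.ofReal_toReal (hfin [n + 1] (by simp))]
    refine (ENNReal.ofReal_le_ofReal hreal).trans ?_
    rw [ENNReal.ofReal_mul hC0, ENNReal.ofReal_mul (Real.exp_pos _).le]
    gcongr
    · exact le_mul_of_one_le_left zero_le (by exact_mod_cast Nat.succ_pos n)
    · exact exp_birkhoff_renPer_le_Znstar _ n
  have huniv : (Set.univ : Set (Space renA)) ⊆ ⋃ n : ℕ, cyl renA [n + 1] := fun x _ =>
    Set.mem_iUnion.2 ⟨x.1 0 - 1, mem_cyl_singleton.2 (by have := renA_apply_zero_pos x; omega)⟩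
  refine ne_top_of_le_ne_top ?_
    ((measure_mono huniv).trans ((measure_iUnion_le _).trans (ENNReal.tsum_le_tsum hcyl)))
  rw [ENNReal.tsum_mul_left]
  exact ENNReal.mul_ne_top ENNReal.ofReal_ne_top
    ((hrec β hβ hββc).2 1 ⟨renPer 0, mem_cyl_singleton.2 (renPer_apply_zero 0)⟩)

end CMS
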